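/- For every s ≥ 1, the Minkowski sum (K(b^s,2) ∪ K(b^s,3) ∪ K(b^s,4)) + K(c^s) is exactly the closed interval [ [0; b^s, 4, \overline{1,3}] + [0; c^s, 4, \overline{1,3}] , [0; b^s, 2, \overline{3,1}] + [0; c^s, \overline{1,3}] ]. -/

import Mathlib

open Filter Set
open scoped Pointwise

noncomputable section

/-- The `n`-th convergent of the continued fraction `[0; a 0, a 1, a 2, …]`. -/
def cfConv : ℕ → (ℕ → ℕ) → ℝ
  | 0, _ => 0
  | n + 1, a => 1 / (a 0 + cfConv n fun i => a (i + 1))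

/-- The value `[0; a 0, a 1, a 2, …]` of the infinite continued fraction with
partial quotients `a 0, a 1, …` (the limit of its convergents). -/
def cfVal (a : ℕ → ℕ) : ℝ := limUnder atTop fun n => cfConv n a

/-- The sequence of partial quotients obtained by concatenating the finite word `b`
with the sequence `θ`. -/
def app (b : List ℕ) (θ : ℕ → ℕ) : ℕ → ℕ := fun n =>
  if h : n < b.length then b.get ⟨n, h⟩ else θ (n - b.length)

/-- The forbidden pairs of consecutive partial quotients. -/
def badPairs : Set (ℕ × ℕ) := {(1, 4), (2, 4)}

/-- The set `D` of sequences with entries in `{1,2,3,4}` avoiding the pairs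
`(1,4)` and `(2,4)`. -/
def Dset : Set (ℕ → ℕ) :=
  {θ | (∀ n, θ n ∈ ({1, 2, 3, 4} : Set ℕ)) ∧ ∀ n, (θ n, θ (n + 1)) ∉ badPairs}

/-- The Cantor set `K(b) = {[0; b, θ] : θ ∈ D, (b_s, θ_1) ∉ {(1,4),(2,4)}}`. -/
def Kb (b : List ℕ) : Set ℝ :=
  {x | ∃ θ ∈ Dset, (∀ d, b.getLast? = some d → (d, θ 0) ∉ badPairs) ∧
    x = cfVal (app b θ)}

/-- The set `K̃(b) ⊆ K(b)` of values `[0; b, θ]` with moreover `(θ_1, θ_2) ≠ (1,3)`. -/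
def Ktil (b : List ℕ) : Set ℝ :=
  {x | ∃ θ ∈ Dset, (∀ d, b.getLast? = some d → (d, θ 0) ∉ badPairs) ∧
    (θ 0, θ 1) ≠ (1, 3) ∧ x = cfVal (app b θ)}

/-- The word `b^s = (1,4)_s`. -/
def bW (s : ℕ) : List ℕ := (List.replicate s [1, 4]).flatten

/-- The word `c^s = (1,4)_{s-1}, 1, 3`. -/
def cW (s : ℕ) : List ℕ := bW (s - 1) ++ [1, 3]

/-- The periodic sequence `\overline{1,3}`. -/
def per13 : ℕ → ℕ := fun n => if n % 2 = 0 then 1 else 3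

/-- The periodic sequence `\overline{3,1}`. -/
def per31 : ℕ → ℕ := fun n => if n % 2 = 0 then 3 else 1

/-! ### Convergence of continued fractions with positive partial quotients -/

lemma cfConv_mem_Icc {a : ℕ → ℕ} (ha : ∀ n, 1 ≤ a n) (n : ℕ) : cfConv n a ∈ Icc (0 : ℝ) 1 := by
  induction n generalizing a with
  | zero => simp [cfConv]
  | succ n ih =>
    have h := ih (a := fun i => a (i + 1)) fun i => ha _
    have h1 : (1 : ℝ) ≤ a 0 := by exact_mod_cast ha 0
    rw [cfConv]
    exact ⟨by have := h.1; positivity, by rw [div_le_one] <;> linarith [h.1]⟩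

lemma abs_two_step_sub_le {a b x y : ℝ} (ha : 1 ≤ a) (hb : 1 ≤ b) (hx : 0 ≤ x) (hy : 0 ≤ y) :
    |1 / (a + 1 / (b + x)) - 1 / (a + 1 / (b + y))| ≤ |x - y| / 4 := by
  have hx2 : 2 ≤ a * (b + x) + 1 := by nlinarith
  have hy2 : 2 ≤ a * (b + y) + 1 := by nlinarith
  have h : 1 / (a + 1 / (b + x)) - 1 / (a + 1 / (b + y))
      = (x - y) / ((a * (b + x) + 1) * (a * (b + y) + 1)) := by
    have : 0 < b + x := by linarith
    have : 0 < b + y := by linarith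
    field_simp
    ring
  have h4 : 4 ≤ (a * (b + x) + 1) * (a * (b + y) + 1) := by nlinarith
  rw [h, abs_div, abs_of_pos (show 0 < (a * (b + x) + 1) * (a * (b + y) + 1) by linarith)]
  gcongr

lemma abs_cfConv_sub_le {a : ℕ → ℕ} (ha : ∀ n, 1 ≤ a n) {N n m : ℕ} (hn : N ≤ n) (hm : N ≤ m) :
    |cfConv n a - cfConv m a| ≤ 2 * (1 / 2) ^ N := by
  induction N using Nat.twoStepInduction generalizing a n m with
  | zero =>
    have h1 := cfConv_mem_Icc ha n
    have h2 := cfConv_mem_Icc ha m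
    rw [abs_le]
    constructor <;> linarith [h1.1, h1.2, h2.1, h2.2]
  | one =>
    have h1 := cfConv_mem_Icc ha n
    have h2 := cfConv_mem_Icc ha m
    rw [abs_le]
    constructor <;> linarith [h1.1, h1.2, h2.1, h2.2]
  | more N ih _ =>
    obtain ⟨n, rfl⟩ := Nat.exists_eq_add_of_le' (le_trans (Nat.le_add_left 2 N) hn)
    obtain ⟨m, rfl⟩ := Nat.exists_eq_add_of_le' (le_trans (Nat.le_add_left 2 N) hm)
    have hs : ∀ i, 1 ≤ a (i + 1 + 1) := fun i => ha _
    have key := ih hs (n := n) (m := m) (by omega) (by omega)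
    have h := abs_two_step_sub_le (a := a 0) (b := a (0 + 1)) (by exact_mod_cast ha 0)
      (by exact_mod_cast ha _) (cfConv_mem_Icc hs n).1 (cfConv_mem_Icc hs m).1
    simp only [cfConv]
    refine h.trans ?_
    rw [pow_add]
    linarith

lemma tendsto_cfConv {a : ℕ → ℕ} (ha : ∀ n, 1 ≤ a n) :
    Tendsto (fun n => cfConv n a) atTop (nhds (cfVal a)) := by
  have hb : Tendsto (fun N : ℕ => (2 : ℝ) * (1 / 2) ^ N) atTop (nhds 0) := by
    simpa using (tendsto_pow_atTop_nhds_zero_of_lt_one (r := (1 / 2 : ℝ)) (by norm_num)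
      (by norm_num)).const_mul 2
  have hc : CauchySeq fun n => cfConv n a :=
    cauchySeq_of_le_tendsto_0 _ (fun n m N hn hm => abs_cfConv_sub_le ha hn hm) hb
  exact hc.tendsto_limUnder

lemma cfVal_mem_Icc {a : ℕ → ℕ} (ha : ∀ n, 1 ≤ a n) : cfVal a ∈ Icc (0 : ℝ) 1 :=
  isClosed_Icc.mem_of_tendsto (tendsto_cfConv ha) (Eventually.of_forall (cfConv_mem_Icc ha))

lemma cfVal_eq {a : ℕ → ℕ} (ha : ∀ n, 1 ≤ a n) :
    cfVal a = 1 / (a 0 + cfVal fun i => a (i + 1)) := by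
  have hs : ∀ i, 1 ≤ a (i + 1) := fun i => ha _
  have h1 : (1 : ℝ) ≤ a 0 := by exact_mod_cast ha 0
  have h := (tendsto_const_nhds (x := (1 : ℝ))).div ((tendsto_cfConv hs).const_add (a 0 : ℝ))
    (by linarith [(cfVal_mem_Icc hs).1])
  exact tendsto_nhds_unique ((tendsto_add_atTop_iff_nat 1).2 (tendsto_cfConv ha)) h

lemma continuousOn_cfConv (n : ℕ) : ContinuousOn (cfConv n) {a | ∀ i, 1 ≤ a i} := by
  induction n with
  | zero => exact continuousOn_const
  | succ n ih =>
    have hshift : Continuous fun (a : ℕ → ℕ) i => a (i + 1) := by fun_prop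
    have h0 : Continuous fun a : ℕ → ℕ => (a 0 : ℝ) :=
      continuous_of_discreteTopology.comp (continuous_apply 0)
    refine ContinuousOn.div continuousOn_const
      (h0.continuousOn.add (ih.comp hshift.continuousOn fun a ha i => ha _)) fun a ha => ?_
    have h1 : (1 : ℝ) ≤ a 0 := by exact_mod_cast ha 0
    have h2 := cfConv_mem_Icc (a := fun i => a (i + 1)) (fun i => ha _) n
    linarith [h2.1]

lemma continuousOn_cfVal : ContinuousOn cfVal {a | ∀ i, 1 ≤ a i} := by
  refine TendstoUniformlyOn.continuousOn (F := cfConv) (p := atTop) ?_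
    (Eventually.of_forall continuousOn_cfConv).frequently
  rw [Metric.tendstoUniformlyOn_iff]
  intro ε hε
  obtain ⟨N, hN⟩ := exists_pow_lt_of_lt_one (show 0 < ε / 2 by positivity)
    (show (1 / 2 : ℝ) < 1 by norm_num)
  filter_upwards [eventually_ge_atTop N] with n hn a ha
  have h : |cfVal a - cfConv n a| ≤ 2 * (1 / 2) ^ N :=
    le_of_tendsto ((tendsto_cfConv ha).sub_const _).abs
      (eventually_atTop.2 ⟨N, fun m hm => abs_cfConv_sub_le ha hm hn⟩)
  rw [Real.dist_eq]
  linarith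

/-! ### Prepending words -/

lemma app_nil (θ : ℕ → ℕ) : app [] θ = θ := by
  funext n
  simp [app]

lemma app_cons_zero (d : ℕ) (w : List ℕ) (θ : ℕ → ℕ) : app (d :: w) θ 0 = d := by
  simp [app]

lemma app_cons_succ (d : ℕ) (w : List ℕ) (θ : ℕ → ℕ) (n : ℕ) :
    app (d :: w) θ (n + 1) = app w θ n := by
  simp [app]

/-- The map `x ↦ [0; w, 1/x]`, i.e. `[0; θ] ↦ [0; w, θ]`. -/
def wordMap : List ℕ → ℝ → ℝ
  | [], x => x
  | d :: w, x => 1 / (d + wordMap w x)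

lemma wordMap_append (w v : List ℕ) (x : ℝ) : wordMap (w ++ v) x = wordMap w (wordMap v x) := by
  induction w with
  | nil => rfl
  | cons d w ih => simp [wordMap, ih]

lemma one_le_app {w : List ℕ} {θ : ℕ → ℕ} (hw : ∀ d ∈ w, 1 ≤ d) (hθ : ∀ n, 1 ≤ θ n) (n : ℕ) :
    1 ≤ app w θ n := by
  unfold app
  split_ifs
  · exact hw _ (List.get_mem _ _)
  · exact hθ _

lemma cfVal_app {w : List ℕ} {θ : ℕ → ℕ} (hw : ∀ d ∈ w, 1 ≤ d) (hθ : ∀ n, 1 ≤ θ n) :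
    cfVal (app w θ) = wordMap w (cfVal θ) := by
  induction w with
  | nil => rw [app_nil, wordMap]
  | cons d w ih =>
    rw [cfVal_eq (one_le_app hw hθ)]
    simp only [app_cons_zero, app_cons_succ, wordMap]
    rw [← ih fun e he => hw e (List.mem_cons_of_mem _ he)]

lemma wordMap_nonneg (w : List ℕ) {x : ℝ} (hx : 0 ≤ x) : 0 ≤ wordMap w x := by
  induction w with
  | nil => exact hx
  | cons d w ih => rw [wordMap]; positivity

lemma continuousOn_wordMap {w : List ℕ} (hw : ∀ d ∈ w, 1 ≤ d) :
    ContinuousOn (wordMap w) (Ici 0) := by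
  induction w with
  | nil => exact continuousOn_id
  | cons d w ih =>
    refine ContinuousOn.div continuousOn_const
      (continuousOn_const.add (ih fun e he => hw e (List.mem_cons_of_mem _ he))) fun x hx => ?_
    have h1 : (1 : ℝ) ≤ d := by exact_mod_cast hw d List.mem_cons_self
    linarith [wordMap_nonneg w hx]

lemma one_le_of_mem_Dset {θ : ℕ → ℕ} (hθ : θ ∈ Dset) (n : ℕ) : 1 ≤ θ n := by
  have := hθ.1 n
  simp only [mem_insert_iff, mem_singleton_iff] at this
  omega

lemma app_singleton_mem_Dset {d : ℕ} {θ : ℕ → ℕ} (hd : d ∈ ({1, 2, 3, 4} : Set ℕ))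
    (hθ : θ ∈ Dset) (h : (d, θ 0) ∉ badPairs) : app [d] θ ∈ Dset := by
  refine ⟨fun n => ?_, fun n => ?_⟩ <;> cases n
  · simpa only [app_cons_zero] using hd
  · simpa only [app_cons_succ, app_nil] using hθ.1 _
  · simpa only [app_cons_zero, app_cons_succ, app_nil] using h
  · simpa only [app_cons_succ, app_nil] using hθ.2 _

lemma shift_mem_Dset {θ : ℕ → ℕ} (hθ : θ ∈ Dset) : (fun i => θ (i + 1)) ∈ Dset :=
  ⟨fun n => hθ.1 (n + 1), fun n => hθ.2 (n + 1)⟩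

/-! ### The extreme values -/

lemma per13_succ : (fun i => per13 (i + 1)) = per31 := by
  funext i
  simp only [per13, per31]
  split_ifs <;> omega

lemma per31_succ : (fun i => per31 (i + 1)) = per13 := by
  funext i
  simp only [per13, per31]
  split_ifs <;> omega

lemma per13_mem_Dset : per13 ∈ Dset := by
  refine ⟨fun n => ?_, fun n => ?_⟩
  · unfold per13; split_ifs <;> simp
  · unfold per13 badPairs; split_ifs <;> simp

lemma per31_mem_Dset : per31 ∈ Dset := per13_succ ▸ shift_mem_Dset per13_mem_Dset

/-- The largest value `[0; \overline{1,3}]` of a sequence in `Dset`. -/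
def top13 : ℝ := cfVal per13

lemma cfVal_per31 : cfVal per31 = 1 / (3 + top13) := by
  rw [cfVal_eq (one_le_of_mem_Dset per31_mem_Dset), per31_succ]
  simp [per31, top13]

lemma top13_eq : top13 = 1 / (1 + 1 / (3 + top13)) := by
  rw [← cfVal_per31, top13]
  conv_lhs => rw [cfVal_eq (one_le_of_mem_Dset per13_mem_Dset), per13_succ]
  simp [per13]

lemma top13_eq' : (1 + (3 + top13)⁻¹)⁻¹ = top13 := by
  simpa using top13_eq.symm

lemma top13_bounds : 0.79128 ≤ top13 ∧ top13 ≤ 0.79129 := by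
  have h0 : 0 ≤ top13 := (cfVal_mem_Icc (one_le_of_mem_Dset per13_mem_Dset)).1
  have h := top13_eq
  have h2 : top13 ^ 2 + 3 * top13 = 3 := by
    field_simp at h
    linarith
  constructor <;> nlinarith

lemma one_div_add_bounds {d x a b l h : ℝ} (hx : a ≤ x ∧ x ≤ b) (hd : 0 < d + a) (hl : 0 ≤ l)
    (hlb : l * (d + b) ≤ 1) (hha : 1 ≤ h * (d + a)) : l ≤ 1 / (d + x) ∧ 1 / (d + x) ≤ h := by
  have hh : 0 ≤ h := by
    by_contra! hneg
    nlinarith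
  rw [le_div_iff₀ (by linarith), div_le_iff₀ (by linarith)]
  constructor <;> nlinarith [hx.1, hx.2]

lemma cfVal_near_range {θ : ℕ → ℕ} (hθ : θ ∈ Dset) (n : ℕ) :
    cfVal θ ≤ top13 + 0.3 * 0.9 ^ n ∧ 1 / (4 + top13) - 0.3 * 0.9 ^ n ≤ cfVal θ ∧
      (θ 0 ≠ 4 → 1 / (3 + top13) - 0.3 * 0.9 ^ n ≤ cfVal θ) := by
  have hα := top13_bounds
  have hβ : 0.26 ≤ 1 / (3 + top13) ∧ 1 / (3 + top13) ≤ 0.27 :=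
    one_div_add_bounds hα (by norm_num) (by norm_num) (by norm_num) (by norm_num)
  have hγ : 0.20 ≤ 1 / (4 + top13) ∧ 1 / (4 + top13) ≤ 0.21 :=
    one_div_add_bounds hα (by norm_num) (by norm_num) (by norm_num) (by norm_num)
  induction n generalizing θ with
  | zero =>
    have h := cfVal_mem_Icc (one_le_of_mem_Dset hθ)
    norm_num
    norm_num at hβ hγ hα
    exact ⟨by linarith [h.2], by linarith [h.1], fun _ => by linarith [h.1]⟩
  | succ n ih =>
    have hD := shift_mem_Dset hθ
    obtain ⟨h1, h2, h3⟩ := ih hD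
    have hy := cfVal_mem_Icc (one_le_of_mem_Dset hD)
    have hδ1 : (0.9 : ℝ) ^ n ≤ 1 := pow_le_one₀ (by norm_num) (by norm_num)
    have hδ0 : (0 : ℝ) < 0.9 ^ n := by positivity
    rw [cfVal_eq (one_le_of_mem_Dset hθ), pow_succ]
    set y := cfVal fun i => θ (i + 1)
    set δ : ℝ := 0.9 ^ n
    have hd := hθ.1 0
    have hbad := hθ.2 0
    set β := 1 / (3 + top13) with hβdef
    set γ := 1 / (4 + top13) with hγdef
    have hαβ : top13 * (1 + β) = 1 := by
      have h := top13_eq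
      rw [← hβdef] at h
      rw [h, one_div, inv_mul_cancel₀ (by linarith)]
    have hβα : β * (3 + top13) = 1 := by
      rw [hβdef, one_div, inv_mul_cancel₀ (by linarith)]
    have hγα : γ * (4 + top13) = 1 := by
      rw [hγdef, one_div, inv_mul_cancel₀ (by linarith)]
    have hd1 : (1 : ℝ) ≤ θ 0 := by exact_mod_cast one_le_of_mem_Dset hθ 0
    have hpos : 0 < (θ 0 : ℝ) + y := by linarith [hy.1]
    have hd4 : (θ 0 : ℝ) ≤ 4 := by
      have : θ 0 ≤ 4 := by
        simp only [mem_insert_iff, mem_singleton_iff] at hd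
        omega
      exact_mod_cast this
    refine ⟨?_, ?_, fun h4 => ?_⟩
    · rw [div_le_iff₀ hpos]
      by_cases h01 : θ 0 = 1
      · have h14 : θ 1 ≠ 4 := by
          intro h
          simp [badPairs, h01, h] at hbad
        have := h3 h14
        rw [h01]
        push_cast
        have hy' : β - 0.3 * δ ≤ y := this
        have : 0 ≤ (top13 + 0.3 * (δ * 0.9)) * (y - (β - 0.3 * δ)) :=
          mul_nonneg (by linarith) (by linarith)
        nlinarith
      · have h2' : (2 : ℝ) ≤ θ 0 := by
          have : 2 ≤ θ 0 := by
            have := one_le_of_mem_Dset hθ 0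
            omega
          exact_mod_cast this
        nlinarith [hy.1]
    · rw [le_div_iff₀ hpos]
      rcases le_total (γ - 0.3 * (δ * 0.9)) 0 with h | h
      · nlinarith
      · have hle : (θ 0 : ℝ) + y ≤ 4 + (top13 + 0.3 * δ) := by linarith
        nlinarith [mul_le_mul_of_nonneg_left hle h]
    · have h3' : (θ 0 : ℝ) ≤ 3 := by
        have : θ 0 ≤ 3 := by
          simp only [mem_insert_iff, mem_singleton_iff] at hd
          omega
        exact_mod_cast this
      rw [le_div_iff₀ hpos]
      rcases le_total (β - 0.3 * (δ * 0.9)) 0 with h | h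
      · nlinarith
      · have hle : (θ 0 : ℝ) + y ≤ 3 + (top13 + 0.3 * δ) := by linarith
        nlinarith [mul_le_mul_of_nonneg_left hle h]

lemma cfVal_range {θ : ℕ → ℕ} (hθ : θ ∈ Dset) :
    cfVal θ ≤ top13 ∧ 1 / (4 + top13) ≤ cfVal θ ∧ (θ 0 ≠ 4 → 1 / (3 + top13) ≤ cfVal θ) := by
  have hδ (c : ℝ) : Tendsto (fun n : ℕ => c - (0.3 : ℝ) * 0.9 ^ n) atTop (nhds c) := by
    simpa using ((tendsto_pow_atTop_nhds_zero_of_lt_one (r := (0.9 : ℝ)) (by norm_num)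
      (by norm_num)).const_mul 0.3).const_sub c
  refine ⟨?_, ?_, fun h4 => ?_⟩
  · refine le_of_tendsto' (hδ (cfVal θ)) fun n => ?_
    linarith [(cfVal_near_range hθ n).1]
  · exact le_of_tendsto' (hδ _) fun n => (cfVal_near_range hθ n).2.1
  · exact le_of_tendsto' (hδ _) fun n => (cfVal_near_range hθ n).2.2 h4

/-! ### Sums of Cantor sets given by trees of bridges -/

/-- An interval `[lo, hi]` meeting a set `pts`, from which an open gap of length `gap` is to be
removed. -/
structure Node where
  /-- The left endpoint. -/
  lo : ℝ
  /-- The right endpoint. -/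
  hi : ℝ
  /-- The length of the gap. -/
  gap : ℝ
  /-- The points to be approximated. -/
  pts : Set ℝ

/-- `N` splits into two nodes satisfying `P` by removing its gap, which is at most as long as the
two remaining intervals. -/
structure Node.Splits (P : Node → Prop) (C : ℝ) (N : Node) : Prop where
  gap_pos : 0 < N.gap
  length_le : N.hi - N.lo ≤ C * N.gap
  exists_mem : ∃ x ∈ N.pts, N.lo ≤ x ∧ x ≤ N.hi
  exists_children : ∃ L R : Node, P L ∧ P R ∧ L.lo = N.lo ∧ R.hi = N.hi ∧ R.lo - L.hi = N.gap ∧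
    N.gap ≤ L.hi - L.lo ∧ N.gap ≤ R.hi - R.lo ∧ L.gap ≤ N.gap ∧ R.gap ≤ N.gap ∧
    L.pts ⊆ N.pts ∧ R.pts ⊆ N.pts

lemma exists_add_near {P : Node → Prop} {C : ℝ} (hC : 1 ≤ C) (hP : ∀ N, P N → N.Splits P C) (n : ℕ)
    {M N : Node} {t : ℝ} (hM : P M) (hN : P N) (hMN : M.gap ≤ N.hi - N.lo)
    (hNM : N.gap ≤ M.hi - M.lo) (ht : t ∈ Icc (M.lo + N.lo) (M.hi + N.hi)) :
    ∃ x ∈ M.pts, ∃ y ∈ N.pts,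
      (x + y - t) ^ 2 ≤ 4 * C * (1 - 1 / C) ^ n * ((M.hi - M.lo) * (N.hi - N.lo)) := by
  have hC1 : 0 ≤ 1 - 1 / C := by
    rw [sub_nonneg, div_le_one (by linarith)]
    exact hC
  induction n generalizing M N with
  | zero =>
    obtain ⟨x, hx, hx1, hx2⟩ := (hP M hM).exists_mem
    obtain ⟨y, hy, hy1, hy2⟩ := (hP N hN).exists_mem
    refine ⟨x, hx, y, hy, ?_⟩
    have h1 := (hP M hM).length_le
    have h2 := (hP N hN).length_le
    have h3 := (hP M hM).gap_pos
    have h4 := (hP N hN).gap_pos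
    have habs : |x + y - t| ≤ (M.hi - M.lo) + (N.hi - N.lo) := by
      rw [abs_le]
      constructor <;> linarith [ht.1, ht.2]
    have hsq : (x + y - t) ^ 2 ≤ ((M.hi - M.lo) + (N.hi - N.lo)) ^ 2 :=
      sq_le_sq' (abs_le.1 habs).1 (abs_le.1 habs).2
    refine hsq.trans ?_
    set l := M.hi - M.lo
    set m := N.hi - N.lo
    have hlm : l ≤ C * m := h1.trans (by gcongr)
    have hml : m ≤ C * l := h2.trans (by gcongr)
    have hl : 0 < l := by linarith
    have hm : 0 < m := by linarith
    rw [pow_zero, mul_one]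
    have := mul_pos hl hm
    nlinarith [mul_le_mul_of_nonneg_left hlm hl.le, mul_le_mul_of_nonneg_left hml hm.le,
      mul_le_mul_of_nonneg_right hC this.le]
  | succ n ih =>
    have step : ∀ {M N : Node}, P M → P N → M.gap ≤ N.hi - N.lo → N.gap ≤ M.gap →
        t ∈ Icc (M.lo + N.lo) (M.hi + N.hi) → ∃ x ∈ M.pts, ∃ y ∈ N.pts,
        (x + y - t) ^ 2 ≤ 4 * C * (1 - 1 / C) ^ (n + 1) * ((M.hi - M.lo) * (N.hi - N.lo)) := by
      intro M N hM hN hMN hgap ht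
      have hm : 0 ≤ N.hi - N.lo := (hP M hM).gap_pos.le.trans hMN
      have hle := (hP M hM).length_le
      have hshrink : M.hi - M.lo - M.gap ≤ (1 - 1 / C) * (M.hi - M.lo) := by
        have : (M.hi - M.lo) / C ≤ M.gap := by
          rw [div_le_iff₀ (by linarith)]
          linarith
        have e : (1 - 1 / C) * (M.hi - M.lo) = M.hi - M.lo - (M.hi - M.lo) / C := by ring
        linarith
      have finish : ∀ K : Node, P K → M.gap ≤ K.hi - K.lo → K.gap ≤ M.gap → K.pts ⊆ M.pts →
          K.hi - K.lo ≤ M.hi - M.lo - M.gap → t ∈ Icc (K.lo + N.lo) (K.hi + N.hi) →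
          ∃ x ∈ M.pts, ∃ y ∈ N.pts, (x + y - t) ^ 2 ≤
            4 * C * (1 - 1 / C) ^ (n + 1) * ((M.hi - M.lo) * (N.hi - N.lo)) := by
        intro K hK h1 h2 h3 h4 htK
        obtain ⟨x, hx, y, hy, hxy⟩ := ih hK hN (h2.trans hMN) (hgap.trans h1) htK
        refine ⟨x, h3 hx, y, hy, hxy.trans ?_⟩
        have : K.hi - K.lo ≤ (1 - 1 / C) * (M.hi - M.lo) := h4.trans hshrink
        calc _ ≤ 4 * C * (1 - 1 / C) ^ n * (((1 - 1 / C) * (M.hi - M.lo)) * (N.hi - N.lo)) := by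
              gcongr
          _ = _ := by ring
      obtain ⟨L, R, hL, hR, hlo, hhi, hLR, hgL, hgR, hLg, hRg, hLs, hRs⟩ :=
        (hP M hM).exists_children
      have hpos := (hP M hM).gap_pos
      rcases le_total t (L.hi + N.hi) with h | h
      · exact finish L hL hgL hLg hLs (by linarith) ⟨by rw [hlo]; exact ht.1, h⟩
      · exact finish R hR hgR hRg hRs (by linarith) ⟨by linarith, by rw [hhi]; exact ht.2⟩
    rcases le_total N.gap M.gap with h | h
    · exact step hM hN hMN h ht
    · obtain ⟨y, hy, x, hx, hxy⟩ := step hN hM hNM h (by rwa [add_comm N.lo, add_comm N.hi])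
      refine ⟨x, hx, y, hy, ?_⟩
      rwa [add_comm x, mul_comm (M.hi - M.lo)]

lemma mem_closure_add {P : Node → Prop} {C : ℝ} (hC : 1 ≤ C) (hP : ∀ N, P N → N.Splits P C)
    {M N : Node} {t : ℝ} (hM : P M) (hN : P N) (hMN : M.gap ≤ N.hi - N.lo)
    (hNM : N.gap ≤ M.hi - M.lo) (ht : t ∈ Icc (M.lo + N.lo) (M.hi + N.hi)) :
    t ∈ closure (M.pts + N.pts) := by
  rw [Metric.mem_closure_iff]
  intro ε hε
  have hlim : Tendsto (fun n : ℕ => 4 * C * (1 - 1 / C) ^ n * ((M.hi - M.lo) * (N.hi - N.lo)))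
      atTop (nhds 0) := by
    have hC0 : 0 < 1 / C := by positivity
    have hC1 : 1 / C ≤ 1 := by
      rw [div_le_one (by linarith)]
      exact hC
    simpa using ((tendsto_pow_atTop_nhds_zero_of_lt_one (r := 1 - 1 / C) (by linarith)
      (by linarith)).const_mul (4 * C)).mul_const ((M.hi - M.lo) * (N.hi - N.lo))
  obtain ⟨n, hn⟩ := (hlim.eventually (gt_mem_nhds (show 0 < ε ^ 2 by positivity))).exists
  obtain ⟨x, hx, y, hy, hxy⟩ := exists_add_near hC hP n hM hN hMN hNM ht
  refine ⟨x + y, add_mem_add hx hy, ?_⟩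
  rw [dist_comm, Real.dist_eq]
  exact abs_lt_of_sq_lt_sq (by linarith) hε.le

/-! ### Increasing fractional linear maps -/

lemma div_mul_le_div_mul {x y a a' b b' k : ℝ} (hx : 0 ≤ x) (ha : 0 < a) (ha' : 0 < a')
    (hb : 0 < b) (hb' : 0 < b') (h : b ≤ k * a) (h' : b' ≤ k * a') (hxy : k ^ 2 * x ≤ y) :
    x / (a * a') ≤ y / (b * b') := by
  rw [div_le_div_iff₀ (by positivity) (by positivity)]
  have hka : 0 ≤ k * a := hb.le.trans h
  calc x * (b * b') ≤ x * ((k * a) * (k * a')) := by gcongr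
    _ = k ^ 2 * x * (a * a') := by ring
    _ ≤ _ := by gcongr

/-- `φ` is an increasing fractional linear map on `[0, ∞)` of determinant one with denominator
`q + q' x`, where `0 ≤ q' ≤ q`. -/
structure IncMoebius (φ : ℝ → ℝ) (q q' : ℝ) : Prop where
  pos : 0 < q
  nonneg : 0 ≤ q'
  le : q' ≤ q
  sub_eq : ∀ {x y : ℝ}, 0 ≤ x → 0 ≤ y → φ x - φ y = (x - y) / ((q + q' * x) * (q + q' * y))

namespace IncMoebius

variable {φ : ℝ → ℝ} {q q' : ℝ}

lemma denom_pos (h : IncMoebius φ q q') {x : ℝ} (hx : 0 ≤ x) : 0 < q + q' * x := by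
  have := h.pos
  have := h.nonneg
  positivity

lemma neg_comp (h : IncMoebius φ q q') {d : ℝ} (hd : 1 ≤ d) :
    IncMoebius (fun x => -φ (1 / (d + x))) (d * q + q') q where
  pos := by nlinarith [h.pos, h.nonneg]
  nonneg := h.pos.le
  le := by nlinarith [h.pos, h.nonneg]
  sub_eq := by
    intro x y hx hy
    have hdx : 0 < d + x := by linarith
    have hdy : 0 < d + y := by linarith
    have h1 := h.denom_pos (show 0 ≤ 1 / (d + x) by positivity)
    have h2 := h.denom_pos (show 0 ≤ 1 / (d + y) by positivity)
    have e1 : d * q + q' + q * x = (q + q' * (1 / (d + x))) * (d + x) := by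
      field_simp
      ring
    have e2 : d * q + q' + q * y = (q + q' * (1 / (d + y))) * (d + y) := by
      field_simp
      ring
    rw [neg_sub_neg, h.sub_eq (by positivity) (by positivity), e1, e2,
      show 1 / (d + y) - 1 / (d + x) = (x - y) / ((d + x) * (d + y)) by field_simp; ring,
      div_div]
    congr 1
    ring

lemma comp_two (h : IncMoebius φ q q') {d e : ℝ} (hd : 1 ≤ d) (he : 1 ≤ e) :
    IncMoebius (fun x => φ (1 / (d + 1 / (e + x)))) (e * (d * q + q') + q) (d * q + q') := by
  simpa using (h.neg_comp hd).neg_comp he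

lemma mono (h : IncMoebius φ q q') {x y : ℝ} (hx : 0 ≤ x) (hxy : x ≤ y) : φ x ≤ φ y := by
  have hy := hx.trans hxy
  rw [← sub_nonneg, h.sub_eq hy hx]
  have := h.denom_pos hx
  have := h.denom_pos hy
  exact div_nonneg (by linarith) (by positivity)

lemma sub_le_mul_sub (h : IncMoebius φ q q') {a b u v k c : ℝ} (ha : 0 ≤ a) (hab : a ≤ b)
    (hu : 0 ≤ u) (huv : u ≤ v) (hua : u - k * a ≤ k - 1) (hvb : v - k * b ≤ k - 1) (hk : 1 ≤ k)
    (hc : k ^ 2 * (b - a) ≤ c * (v - u)) : φ b - φ a ≤ c * (φ v - φ u) := by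
  have hb := ha.trans hab
  have hv := hu.trans huv
  have h1 := h.pos
  have h2 := h.nonneg
  have h3 := h.le
  have key : ∀ {x y : ℝ}, y - k * x ≤ k - 1 → q + q' * y ≤ k * (q + q' * x) := by
    intro x y hxy
    nlinarith [mul_le_mul_of_nonneg_left hxy h2]
  have ku := key hua
  have kv := key hvb
  have pa := h.denom_pos ha
  have pb := h.denom_pos hb
  have pu := h.denom_pos hu
  have pv := h.denom_pos hv
  rw [h.sub_eq hb ha, h.sub_eq hv hu, ← mul_div_assoc]
  exact div_mul_le_div_mul (by linarith) pb pa pv pu kv ku hc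

lemma sub_le_left (h : IncMoebius φ q q') {a u v : ℝ} (ha : 0 ≤ a) (hau : a ≤ u) (huv : u ≤ v)
    (hle : v - u ≤ u - a) : φ v - φ u ≤ φ u - φ a := by
  have hu := ha.trans hau
  have hv := hu.trans huv
  have pa := h.denom_pos ha
  have pu := h.denom_pos hu
  have pv := h.denom_pos hv
  rw [h.sub_eq hv hu, h.sub_eq hu ha, div_le_div_iff₀ (by positivity) (by positivity)]
  have : (v - u) * (q + q' * a) ≤ (u - a) * (q + q' * v) := by
    have : q + q' * a ≤ q + q' * v := by nlinarith [h.nonneg]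
    exact mul_le_mul hle this pa.le (by linarith)
  nlinarith

lemma sub_le_right (h : IncMoebius φ q q') {u v b : ℝ} (hu : 0 ≤ u) (huv : u ≤ v) (hvb : v ≤ b)
    (hk : b - 5 / 4 * u ≤ 1 / 4) (hle : 5 / 4 * (v - u) ≤ b - v) : φ v - φ u ≤ φ b - φ v := by
  have hv := hu.trans huv
  have hb := hv.trans hvb
  have pu := h.denom_pos hu
  have pv := h.denom_pos hv
  have pb := h.denom_pos hb
  rw [h.sub_eq hv hu, h.sub_eq hb hv, div_le_div_iff₀ (by positivity) (by positivity)]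
  have hq : q + q' * b ≤ 5 / 4 * (q + q' * u) := by
    nlinarith [mul_le_mul_of_nonneg_left hk h.nonneg, h.le]
  have : (v - u) * (q + q' * b) ≤ (b - v) * (q + q' * u) := by
    nlinarith [mul_le_mul_of_nonneg_left hq (sub_nonneg.2 huv),
      mul_le_mul_of_nonneg_right hle pu.le]
  nlinarith

end IncMoebius

/-! ### The bridges of the Cantor set of values of `Dset` -/

/-- The sets of consecutive first digits arising when the gaps between digits are removed one
after the other, from right to left. -/
inductive Digits
  | d1234
  | d234
  | d34
  | d123
  | d23

namespace Digits

/-- The digits. -/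
def toSet : Digits → Set ℕ
  | d1234 => {1, 2, 3, 4}
  | d234 => {2, 3, 4}
  | d34 => {3, 4}
  | d123 => {1, 2, 3}
  | d23 => {2, 3}

/-- The least value with first digit in the given set. -/
def lo : Digits → ℝ
  | d1234 | d234 | d34 => 1 / (4 + top13)
  | d123 | d23 => 1 / (3 + top13)

/-- The left endpoint of the rightmost gap between digits. -/
def gapLo : Digits → ℝ
  | d1234 | d123 => 1 / (2 + 1 / (3 + top13))
  | d234 | d23 => 1 / (3 + 1 / (4 + top13))
  | d34 => 1 / (4 + 1 / (4 + top13))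

/-- The right endpoint of the rightmost gap between digits. -/
def gapHi : Digits → ℝ
  | d1234 | d123 => 1 / (1 + top13)
  | d234 | d23 => 1 / (2 + top13)
  | d34 => 1 / (3 + top13)

/-- The largest value with first digit in the given set. -/
def hi : Digits → ℝ
  | d1234 | d123 => top13
  | d234 | d23 => 1 / (2 + 1 / (3 + top13))
  | d34 => 1 / (3 + 1 / (4 + top13))

/-- The sequences in `Dset` with first digit in the given set. -/
def seqs (B : Digits) : Set (ℕ → ℕ) := {θ ∈ Dset | θ 0 ∈ B.toSet}

/-- The values of the sequences in `Dset` with first digit in the given set. -/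
def vals (B : Digits) : Set ℝ := cfVal '' B.seqs

lemma isCompact_seqs (B : Digits) : IsCompact B.seqs := by
  have hK : IsCompact (Set.pi univ fun _ : ℕ => ({1, 2, 3, 4} : Set ℕ)) :=
    isCompact_univ_pi fun _ => (Set.toFinite _).isCompact
  have hpair (n : ℕ) : Continuous fun θ : ℕ → ℕ => (θ n, θ (n + 1)) := by fun_prop
  have h : B.seqs = (Set.pi univ fun _ : ℕ => ({1, 2, 3, 4} : Set ℕ)) ∩
      ((⋂ n, (fun θ : ℕ → ℕ => (θ n, θ (n + 1))) ⁻¹' badPairsᶜ) ∩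
        (fun θ : ℕ → ℕ => θ 0) ⁻¹' B.toSet) := by
    ext θ
    simp only [seqs, Dset, mem_ofPred_eq, mem_inter_iff, Set.mem_pi, mem_univ, true_implies,
      mem_iInter, mem_preimage, mem_compl_iff, and_assoc]
  rw [h]
  exact hK.inter_right ((isClosed_iInter fun n => (isClosed_discrete _).preimage (hpair n)).inter
    ((isClosed_discrete _).preimage (continuous_apply 0)))

lemma nonneg_of_mem_vals {B : Digits} {x : ℝ} (hx : x ∈ B.vals) : 0 ≤ x := by
  obtain ⟨θ, hθ, rfl⟩ := hx
  exact (cfVal_mem_Icc (one_le_of_mem_Dset hθ.1)).1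

lemma isCompact_vals (B : Digits) : IsCompact B.vals :=
  B.isCompact_seqs.image_of_continuousOn
    (continuousOn_cfVal.mono fun _ hθ => one_le_of_mem_Dset hθ.1)

lemma toSet_subset (B : Digits) : B.toSet ⊆ {1, 2, 3, 4} := by
  intro d
  cases B <;> simp only [toSet, mem_insert_iff, mem_singleton_iff] <;> omega

lemma cfVal_app_singleton {d : ℕ} (hd : 1 ≤ d) {θ : ℕ → ℕ} (hθ : θ ∈ Dset) :
    cfVal (app [d] θ) = 1 / (d + cfVal θ) := by
  rw [cfVal_app (by simpa using hd) (one_le_of_mem_Dset hθ), wordMap, wordMap]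

lemma mem_vals_iff {B : Digits} {x : ℝ} : x ∈ B.vals ↔
    ∃ d ∈ B.toSet, ∃ θ ∈ Dset, (d, θ 0) ∉ badPairs ∧ x = 1 / (d + cfVal θ) := by
  constructor
  · rintro ⟨θ, hθ, rfl⟩
    exact ⟨θ 0, hθ.2, _, shift_mem_Dset hθ.1, hθ.1.2 0, cfVal_eq (one_le_of_mem_Dset hθ.1)⟩
  · rintro ⟨d, hd, θ, hθ, hbad, rfl⟩
    have hd' := B.toSet_subset hd
    refine ⟨app [d] θ, ⟨app_singleton_mem_Dset hd' hθ hbad, by rwa [app_cons_zero]⟩, ?_⟩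
    refine cfVal_app_singleton ?_ hθ
    simp only [mem_insert_iff, mem_singleton_iff] at hd'
    omega

lemma vals_mono {B B' : Digits} (h : B.toSet ⊆ B'.toSet) : B.vals ⊆ B'.vals :=
  image_mono fun _ hθ => ⟨hθ.1, h hθ.2⟩

lemma one_div_mem_vals {B B' : Digits} {d : ℕ} (hd : d ∈ B.toSet)
    (h : ∀ e ∈ B'.toSet, (d, e) ∉ badPairs) {x : ℝ} (hx : x ∈ B'.vals) :
    1 / (d + x) ∈ B.vals := by
  obtain ⟨θ, hθ, rfl⟩ := hx
  exact mem_vals_iff.2 ⟨d, hd, θ, hθ.1, h _ hθ.2, rfl⟩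

lemma top13_mem_vals {B : Digits} (h : 1 ∈ B.toSet) : top13 ∈ B.vals :=
  ⟨per13, ⟨per13_mem_Dset, by simpa [per13] using h⟩, rfl⟩

lemma endpoint_bounds :
    (0.26376 ≤ 1 / (3 + top13) ∧ 1 / (3 + top13) ≤ 0.26377) ∧
    (0.20871 ≤ 1 / (4 + top13) ∧ 1 / (4 + top13) ≤ 0.20872) ∧
    (0.35825 ≤ 1 / (2 + top13) ∧ 1 / (2 + top13) ≤ 0.35826) ∧
    (0.55825 ≤ 1 / (1 + top13) ∧ 1 / (1 + top13) ≤ 0.55827) ∧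
    (0.44174 ≤ 1 / (2 + 1 / (3 + top13)) ∧ 1 / (2 + 1 / (3 + top13)) ≤ 0.44175) ∧
    (0.31165 ≤ 1 / (3 + 1 / (4 + top13)) ∧ 1 / (3 + 1 / (4 + top13)) ≤ 0.31166) ∧
    (0.23760 ≤ 1 / (4 + 1 / (4 + top13)) ∧ 1 / (4 + 1 / (4 + top13)) ≤ 0.23761) := by
  have hα := top13_bounds
  have h3 : 0.26376 ≤ 1 / (3 + top13) ∧ 1 / (3 + top13) ≤ 0.26377 := by
    apply one_div_add_bounds hα <;> norm_num
  have h4 : 0.20871 ≤ 1 / (4 + top13) ∧ 1 / (4 + top13) ≤ 0.20872 := by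
    apply one_div_add_bounds hα <;> norm_num
  refine ⟨h3, h4, ?_, ?_, ?_, ?_, ?_⟩
  · apply one_div_add_bounds hα <;> norm_num
  · apply one_div_add_bounds hα <;> norm_num
  · apply one_div_add_bounds h3 <;> norm_num
  · apply one_div_add_bounds h4 <;> norm_num
  · apply one_div_add_bounds h4 <;> norm_num

/-- The endpoints are ordered, and the gap is shorter than both bridges by margins that
absorb the distortion of fractional linear maps. -/
lemma endpoint_ineqs (B : Digits) :
    0.2 ≤ B.lo ∧ B.lo ≤ B.gapLo ∧ B.gapLo < B.gapHi ∧ B.gapHi ≤ B.hi ∧ B.hi ≤ 1 ∧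
    B.gapHi - B.gapLo ≤ B.gapLo - B.lo ∧ 5 / 4 * (B.gapHi - B.gapLo) ≤ B.hi - B.gapHi ∧
    B.hi - 5 / 4 * B.gapLo ≤ 1 / 4 ∧ 4 * (B.hi - B.lo) ≤ 32 * (B.gapHi - B.gapLo) := by
  have hα := top13_bounds
  obtain ⟨h1, h2, h3, h4, h5, h6, h7⟩ := endpoint_bounds
  norm_num only at hα h1 h2 h3 h4 h5 h6 h7
  cases B <;> simp only [lo, gapLo, gapHi, hi] <;> norm_num only <;>
    refine ⟨?_, ?_, ?_, ?_, ?_, ?_, ?_, ?_, ?_⟩ <;> linarith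

lemma exists_mem_vals (B : Digits) : ∃ x ∈ B.vals, B.lo ≤ x ∧ x ≤ B.hi := by
  obtain ⟨-, h1, h2, h3, -⟩ := B.endpoint_ineqs
  have h13 : top13 ∈ d1234.vals := top13_mem_vals (by simp [toSet])
  have hlohi : B.lo ≤ B.hi := by linarith
  cases B
  · exact ⟨top13, h13, hlohi, le_rfl⟩
  · exact ⟨_, one_div_mem_vals (d := 4) (by simp [toSet]) (by simp [badPairs]) h13,
      le_rfl, hlohi⟩
  · exact ⟨_, one_div_mem_vals (d := 4) (by simp [toSet]) (by simp [badPairs]) h13,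
      le_rfl, hlohi⟩
  · exact ⟨top13, top13_mem_vals (by simp [toSet]), hlohi, le_rfl⟩
  · exact ⟨_, one_div_mem_vals (d := 3) (by simp [toSet]) (by simp [badPairs]) h13,
      le_rfl, hlohi⟩

lemma vals_d1234_subset : d1234.vals ⊆ Icc d1234.lo d1234.hi := by
  rintro _ ⟨θ, hθ, rfl⟩
  exact ⟨(cfVal_range hθ.1).2.1, (cfVal_range hθ.1).1⟩

lemma vals_d234_subset : d234.vals ⊆ Icc d234.lo d234.hi := by
  intro x hx
  refine ⟨(vals_d1234_subset (vals_mono (by simp [toSet]) hx)).1, ?_⟩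
  obtain ⟨d, hd, θ, hθ, hbad, rfl⟩ := mem_vals_iff.1 hx
  obtain ⟨-, h4, h3⟩ := cfVal_range hθ
  have hα := top13_bounds
  have hβ := endpoint_bounds.1
  have hγ := endpoint_bounds.2.1
  simp only [toSet, mem_insert_iff, mem_singleton_iff] at hd
  apply one_div_le_one_div_of_le
  · linarith
  · rcases hd with rfl | rfl | rfl
    · have : θ 0 ≠ 4 := fun h => hbad (by simp [badPairs, h])
      simpa using h3 this
    all_goals
      push_cast
      linarith

/-- The image of a bridge under a map. -/
def node (B : Digits) (φ : ℝ → ℝ) : Node :=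
  ⟨φ B.lo, φ B.hi, φ B.gapHi - φ B.gapLo, φ '' B.vals⟩

end Digits

/-- The reflection of a node in the origin. -/
def Node.neg (N : Node) : Node := ⟨-N.hi, -N.lo, N.gap, -N.pts⟩

/-- The nodes that are images of bridges under fractional linear maps of either orientation. -/
inductive IsBridge : Node → Prop
  | pos {φ : ℝ → ℝ} {q q' : ℝ} (h : IncMoebius φ q q') (B : Digits) : IsBridge (B.node φ)
  | neg {φ : ℝ → ℝ} {q q' : ℝ} (h : IncMoebius φ q q') (B : Digits) : IsBridge (B.node φ).neg

lemma IsBridge.reflect {N : Node} (h : IsBridge N) : IsBridge N.neg := by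
  cases h with
  | pos h B => exact .neg h B
  | neg h B => simpa [Node.neg] using IsBridge.pos h B

lemma Node.Splits.reflect {C : ℝ} {N : Node} (h : N.Splits IsBridge C) :
    N.neg.Splits IsBridge C where
  gap_pos := h.gap_pos
  length_le := by
    have := h.length_le
    simp only [Node.neg]
    linarith
  exists_mem := by
    obtain ⟨x, hx, h1, h2⟩ := h.exists_mem
    exact ⟨-x, by simpa [Node.neg] using hx, neg_le_neg h2, neg_le_neg h1⟩
  exists_children := by
    obtain ⟨L, R, hL, hR, hlo, hhi, hLR, hgL, hgR, hLg, hRg, hLs, hRs⟩ := h.exists_children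
    refine ⟨R.neg, L.neg, hR.reflect, hL.reflect, ?_, ?_, ?_, ?_, ?_, hRg, hLg,
      Set.neg_subset_neg.2 hRs, Set.neg_subset_neg.2 hLs⟩ <;> simp only [Node.neg] <;> linarith

/-- The part of the image of a bridge consisting of continued fractions with first digit `d`. -/
def digitNode (φ : ℝ → ℝ) (d : ℕ) (B : Digits) : Node := (B.node fun x => -φ (1 / (d + x))).neg

namespace IncMoebius

variable {φ : ℝ → ℝ} {q q' : ℝ}

lemma isBridge_digitNode (h : IncMoebius φ q q') {d : ℕ} (hd : 1 ≤ d) (B : Digits) :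
    IsBridge (digitNode φ d B) :=
  .neg (h.neg_comp (by exact_mod_cast hd)) B

lemma digitNode_pts_subset {B B' : Digits} {d : ℕ} (hd : d ∈ B.toSet)
    (h : ∀ e ∈ B'.toSet, (d, e) ∉ badPairs) : (digitNode φ d B').pts ⊆ (B.node φ).pts := by
  intro x hx
  simp only [digitNode, Node.neg, Digits.node, Set.mem_neg] at hx
  obtain ⟨y, hy, hxy⟩ := hx
  exact ⟨_, Digits.one_div_mem_vals hd h hy, neg_injective hxy⟩

lemma node_gap_le (h : IncMoebius φ q q') {B B' : Digits}
    (hv : B.gapHi - 5 / 4 * B'.gapHi ≤ 1 / 4)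
    (hle : 25 / 16 * (B'.gapHi - B'.gapLo) ≤ B.gapHi - B.gapLo) :
    (B'.node φ).gap ≤ (B.node φ).gap := by
  obtain ⟨h1, h2, h3, -⟩ := B.endpoint_ineqs
  obtain ⟨h1', h2', h3', -⟩ := B'.endpoint_ineqs
  have := h.sub_le_mul_sub (a := B'.gapLo) (b := B'.gapHi) (u := B.gapLo) (v := B.gapHi)
    (k := 5 / 4) (c := 1) (by linarith) h3'.le (by linarith) h3.le (by linarith) (by linarith)
    (by norm_num) (by linarith)
  rwa [one_mul] at this

lemma digitNode_gap_le (h : IncMoebius φ q q') {B B' : Digits} {d : ℕ} {a b : ℝ} (ha : 0 ≤ a)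
    (hab : a ≤ 1 / (d + B'.gapHi) ∧ 1 / (d + B'.gapLo) ≤ b)
    (hv : B.gapHi - 5 / 4 * a ≤ 1 / 4)
    (hle : 25 / 16 * (b - a) ≤ B.gapHi - B.gapLo) :
    (digitNode φ d B').gap ≤ (B.node φ).gap := by
  obtain ⟨h1, h2, h3, -⟩ := B.endpoint_ineqs
  obtain ⟨h1', h2', h3', -⟩ := B'.endpoint_ineqs
  have hd : (0 : ℝ) ≤ d := d.cast_nonneg
  have hmono : 1 / (d + B'.gapHi) ≤ 1 / (d + B'.gapLo) :=
    one_div_le_one_div_of_le (by linarith) (by linarith)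
  have := h.sub_le_mul_sub (a := 1 / (d + B'.gapHi)) (b := 1 / (d + B'.gapLo)) (u := B.gapLo)
    (v := B.gapHi) (k := 5 / 4) (c := 1) (by linarith) hmono (by linarith) h3.le (by linarith)
    (by linarith) (by norm_num) (by linarith)
  simp only [digitNode, Node.neg, Digits.node]
  linarith

lemma splits_of_children (h : IncMoebius φ q q') {B : Digits} {L R : Node} (hL : IsBridge L)
    (hR : IsBridge R) (hL1 : L.lo = φ B.lo) (hL2 : L.hi = φ B.gapLo) (hR1 : R.lo = φ B.gapHi)
    (hR2 : R.hi = φ B.hi) (hLg : L.gap ≤ (B.node φ).gap) (hRg : R.gap ≤ (B.node φ).gap)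
    (hLs : L.pts ⊆ (B.node φ).pts) (hRs : R.pts ⊆ (B.node φ).pts) :
    (B.node φ).Splits IsBridge 32 := by
  obtain ⟨h1, h2, h3, h4, h5, h6, h7, h8, h9⟩ := B.endpoint_ineqs
  refine ⟨?_, ?_, ?_, L, R, hL, hR, hL1, hR2, ?_, ?_, ?_, hLg, hRg, hLs, hRs⟩
  · simp only [Digits.node]
    rw [h.sub_eq (by linarith) (by linarith)]
    have := h.denom_pos (show 0 ≤ B.gapLo by linarith)
    have := h.denom_pos (show 0 ≤ B.gapHi by linarith)
    exact div_pos (by linarith) (by positivity)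
  · exact h.sub_le_mul_sub (k := 2) (by linarith) (by linarith) (by linarith) h3.le
      (by linarith) (by linarith) (by norm_num) (by linarith)
  · obtain ⟨x, hx, hx1, hx2⟩ := B.exists_mem_vals
    exact ⟨φ x, mem_image_of_mem φ hx, h.mono (by linarith) hx1, h.mono (by linarith) hx2⟩
  · rw [hL2, hR1, Digits.node]
  · rw [hL1, hL2]
    exact h.sub_le_left (by linarith) h2 h3.le h6
  · rw [hR1, hR2]
    exact h.sub_le_right (by linarith) h3.le h4 h8 h7

lemma splits_node (h : IncMoebius φ q q') (B : Digits) : (B.node φ).Splits IsBridge 32 := by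
  have hα := top13_bounds
  obtain ⟨h1, h2, h3, h4, h5, h6, h7⟩ := Digits.endpoint_bounds
  have hgap (d : ℕ) {l l' : ℝ} (hl : 0 ≤ l) (hl1 : l * (d + 0.55827) ≤ 1)
      (hl' : 1 ≤ l' * (d + 0.44174)) :
      l ≤ 1 / (d + 1 / (1 + top13)) ∧ 1 / (d + 1 / (2 + 1 / (3 + top13))) ≤ l' := by
    have hd : (0 : ℝ) ≤ d := d.cast_nonneg
    have e1 : (d : ℝ) + 1 / (1 + top13) ≤ d + 0.55827 := by linarith
    have e2 : (d : ℝ) + 0.44174 ≤ d + 1 / (2 + 1 / (3 + top13)) := by linarith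
    have e3 : 0 ≤ l' := by
      by_contra! hneg
      nlinarith
    rw [le_div_iff₀ (by linarith), div_le_iff₀ (by linarith)]
    exact ⟨(mul_le_mul_of_nonneg_left e1 hl).trans hl1,
      hl'.trans (mul_le_mul_of_nonneg_left e2 e3)⟩
  have hgap1 := hgap 1 (l := 0.6417) (l' := 0.6937) (by norm_num) (by norm_num) (by norm_num)
  have hgap2 := hgap 2 (l := 0.3908) (l' := 0.4096) (by norm_num) (by norm_num) (by norm_num)
  have hgap3 := hgap 3 (l := 0.2810) (l' := 0.2906) (by norm_num) (by norm_num) (by norm_num)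
  have hgap4 := hgap 4 (l := 0.2193) (l' := 0.2252) (by norm_num) (by norm_num) (by norm_num)
  clear hgap
  cases B
  · refine h.splits_of_children (L := Digits.d234.node φ) (R := digitNode φ 1 .d123) (.pos h _)
      (h.isBridge_digitNode le_rfl _) rfl rfl ?_ ?_ (h.node_gap_le ?_ ?_)
      (h.digitNode_gap_le ?_ hgap1 ?_ ?_)
      (image_mono (Digits.vals_mono (by simp [Digits.toSet]))) (digitNode_pts_subset ?_ ?_)
    all_goals first
      | positivity
      | simp only [Digits.gapLo, Digits.gapHi]; linarith
      | simp [digitNode, Node.neg, Digits.node, Digits.lo, Digits.gapLo, Digits.gapHi, Digits.hi,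
          Digits.toSet, badPairs, top13_eq']
  · refine h.splits_of_children (L := Digits.d34.node φ) (R := digitNode φ 2 .d123) (.pos h _)
      (h.isBridge_digitNode (by norm_num) _) rfl rfl ?_ ?_ (h.node_gap_le ?_ ?_)
      (h.digitNode_gap_le ?_ hgap2 ?_ ?_)
      (image_mono (Digits.vals_mono (by simp [Digits.toSet]))) (digitNode_pts_subset ?_ ?_)
    all_goals first
      | positivity
      | simp only [Digits.gapLo, Digits.gapHi]; linarith
      | simp [digitNode, Node.neg, Digits.node, Digits.lo, Digits.gapLo, Digits.gapHi, Digits.hi,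
          Digits.toSet, badPairs]
  · refine h.splits_of_children (L := digitNode φ 4 .d1234) (R := digitNode φ 3 .d1234)
      (h.isBridge_digitNode (by norm_num) _)
      (h.isBridge_digitNode (by norm_num) _) ?_ ?_ ?_ ?_ (h.digitNode_gap_le ?_ hgap4 ?_ ?_)
      (h.digitNode_gap_le ?_ hgap3 ?_ ?_)
      (digitNode_pts_subset ?_ ?_) (digitNode_pts_subset ?_ ?_)
    all_goals first
      | positivity
      | simp only [Digits.gapLo, Digits.gapHi]; linarith
      | simp [digitNode, Node.neg, Digits.node, Digits.lo, Digits.gapLo, Digits.gapHi, Digits.hi,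
          Digits.toSet, badPairs]
  · refine h.splits_of_children (L := Digits.d23.node φ) (R := digitNode φ 1 .d123) (.pos h _)
      (h.isBridge_digitNode le_rfl _) rfl rfl ?_ ?_ (h.node_gap_le ?_ ?_)
      (h.digitNode_gap_le ?_ hgap1 ?_ ?_)
      (image_mono (Digits.vals_mono (by simp [Digits.toSet]))) (digitNode_pts_subset ?_ ?_)
    all_goals first
      | positivity
      | simp only [Digits.gapLo, Digits.gapHi]; linarith
      | simp [digitNode, Node.neg, Digits.node, Digits.lo, Digits.gapLo, Digits.gapHi, Digits.hi,
          Digits.toSet, badPairs, top13_eq']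
  · refine h.splits_of_children (L := digitNode φ 3 .d1234) (R := digitNode φ 2 .d123)
      (h.isBridge_digitNode (by norm_num) _)
      (h.isBridge_digitNode (by norm_num) _) ?_ ?_ ?_ ?_ (h.digitNode_gap_le ?_ hgap3 ?_ ?_)
      (h.digitNode_gap_le ?_ hgap2 ?_ ?_)
      (digitNode_pts_subset ?_ ?_) (digitNode_pts_subset ?_ ?_)
    all_goals first
      | positivity
      | simp only [Digits.gapLo, Digits.gapHi]; linarith
      | simp [digitNode, Node.neg, Digits.node, Digits.lo, Digits.gapLo, Digits.gapHi, Digits.hi,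
          Digits.toSet, badPairs]

end IncMoebius

lemma IsBridge.splits {N : Node} (hN : IsBridge N) : N.Splits IsBridge 32 := by
  cases hN with
  | pos h B => exact h.splits_node B
  | neg h B => exact (h.splits_node B).reflect

/-! ### The words `b^s` and `c^s` -/

lemma bW_succ (s : ℕ) : bW (s + 1) = bW s ++ [1, 4] := by
  simp [bW, List.replicate_succ']

lemma one_le_of_mem_bW {s d : ℕ} (hd : d ∈ bW s) : 1 ≤ d := by
  simp only [bW, List.mem_flatten, List.mem_replicate] at hd
  obtain ⟨l, ⟨-, rfl⟩, hd⟩ := hd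
  simp only [List.mem_cons, List.not_mem_nil, or_false] at hd
  omega

lemma exists_incMoebius_wordMap_bW (s : ℕ) : ∃ q q', IncMoebius (wordMap (bW s)) q q' := by
  induction s with
  | zero =>
    refine ⟨1, 0, one_pos, le_rfl, zero_le_one, ?_⟩
    intro x y _ _
    simp [bW, wordMap]
  | succ s ih =>
    obtain ⟨q, q', h⟩ := ih
    have e : wordMap (bW (s + 1)) = fun x => wordMap (bW s) (1 / (1 + 1 / (4 + x))) := by
      funext x
      simp [bW_succ, wordMap_append, wordMap]
    exact e ▸ ⟨_, _, h.comp_two le_rfl (by norm_num)⟩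

lemma Kb_append_singleton {w : List ℕ} (hw : ∀ d ∈ w, 1 ≤ d) {j : ℕ} (hj : 1 ≤ j) :
    Kb (w ++ [j]) = wordMap w '' {x | ∃ θ ∈ Dset, (j, θ 0) ∉ badPairs ∧ x = 1 / (j + cfVal θ)} := by
  have hwj : ∀ d ∈ w ++ [j], 1 ≤ d := by
    intro d hd
    rcases List.mem_append.1 hd with h | h
    · exact hw d h
    · rwa [List.mem_singleton.1 h]
  ext x
  constructor
  · rintro ⟨θ, hθ, hbad, rfl⟩
    refine ⟨_, ⟨θ, hθ, hbad j (by simp), rfl⟩, ?_⟩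
    rw [cfVal_app hwj (one_le_of_mem_Dset hθ), wordMap_append, wordMap, wordMap]
  · rintro ⟨_, ⟨θ, hθ, hbad, rfl⟩, rfl⟩
    refine ⟨θ, hθ, fun d hd => ?_, ?_⟩
    · have : j = d := by simpa using hd
      exact this ▸ hbad
    · rw [cfVal_app hwj (one_le_of_mem_Dset hθ), wordMap_append, wordMap, wordMap]

lemma Kb_union_eq {w : List ℕ} (hw : ∀ d ∈ w, 1 ≤ d) :
    Kb (w ++ [2]) ∪ Kb (w ++ [3]) ∪ Kb (w ++ [4]) = wordMap w '' Digits.d234.vals := by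
  rw [Kb_append_singleton hw (by norm_num), Kb_append_singleton hw (by norm_num),
    Kb_append_singleton hw (by norm_num), ← image_union, ← image_union]
  congr 1
  ext x
  simp only [Digits.mem_vals_iff, Digits.toSet, mem_union, mem_ofPred_eq, mem_insert_iff,
    mem_singleton_iff, exists_eq_or_imp, exists_eq_left, or_assoc]

lemma Kb_append_three {w : List ℕ} (hw : ∀ d ∈ w, 1 ≤ d) :
    Kb (w ++ [3]) = wordMap (w ++ [3]) '' Digits.d1234.vals := by
  rw [Kb_append_singleton hw (by norm_num)]
  ext x
  constructor
  · rintro ⟨_, ⟨θ, hθ, -, rfl⟩, rfl⟩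
    exact ⟨cfVal θ, ⟨θ, ⟨hθ, hθ.1 0⟩, rfl⟩, by rw [wordMap_append, wordMap, wordMap]⟩
  · rintro ⟨_, ⟨θ, hθ, rfl⟩, rfl⟩
    exact ⟨_, ⟨θ, hθ.1, by simp [badPairs], rfl⟩, by rw [wordMap_append, wordMap, wordMap]⟩

/-- The compatibility of the gaps and lengths of the first bridges. -/
lemma gap_le_length {φ : ℝ → ℝ} {q q' : ℝ} (h : IncMoebius φ q q') :
    (Digits.d234.node fun x => φ (1 / (1 + 1 / (4 + x)))).gap ≤
      (Digits.d1234.node fun x => φ (1 / (1 + 1 / (3 + x)))).hi -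
        (Digits.d1234.node fun x => φ (1 / (1 + 1 / (3 + x)))).lo ∧
    (Digits.d1234.node fun x => φ (1 / (1 + 1 / (3 + x)))).gap ≤
      (Digits.d234.node fun x => φ (1 / (1 + 1 / (4 + x)))).hi -
        (Digits.d234.node fun x => φ (1 / (1 + 1 / (4 + x)))).lo := by
  have h3 := h.comp_two (d := 1) (e := 3) le_rfl (by norm_num)
  have h4 := h.comp_two (d := 1) (e := 4) le_rfl (by norm_num)
  obtain ⟨a1, a2, a3, a4, a5, -⟩ := Digits.d234.endpoint_ineqs
  obtain ⟨b1, b2, b3, b4, b5, -⟩ := Digits.d1234.endpoint_ineqs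
  have hα := top13_bounds
  obtain ⟨e1, e2, e3, e4, e5, e6, e7⟩ := Digits.endpoint_bounds
  have hq := h.pos
  have hq' := h.nonneg
  have key {x y : ℝ} (hxy : y - 5 / 4 * x ≤ -0.25) :
      4 * (1 * q + q') + q + (1 * q + q') * y ≤
        5 / 4 * (3 * (1 * q + q') + q + (1 * q + q') * x) := by
    nlinarith [mul_le_mul_of_nonneg_left hxy (show 0 ≤ 1 * q + q' by linarith)]
  have key' {x y : ℝ} (hx : 0 ≤ x) (hy : y ≤ 1) :
      3 * (1 * q + q') + q + (1 * q + q') * y ≤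
        1 * (4 * (1 * q + q') + q + (1 * q + q') * x) := by
    nlinarith [mul_le_mul_of_nonneg_left hy (show 0 ≤ 1 * q + q' by linarith),
      mul_nonneg (show 0 ≤ 1 * q + q' by linarith) hx]
  simp only [Digits.node]
  rw [h4.sub_eq (by linarith) (by linarith), h3.sub_eq (by linarith) (by linarith),
    h3.sub_eq (by linarith) (by linarith), h4.sub_eq (by linarith) (by linarith)]
  constructor
  · refine div_mul_le_div_mul (k := 1) (by linarith) (h4.denom_pos ?_) (h4.denom_pos ?_)
      (h3.denom_pos ?_) (h3.denom_pos ?_) (key' ?_ ?_) (key' ?_ ?_) ?_ <;>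
      simp only [Digits.lo, Digits.gapLo, Digits.gapHi, Digits.hi] at * <;> linarith
  · refine div_mul_le_div_mul (k := 5 / 4) (by linarith) (h3.denom_pos ?_) (h3.denom_pos ?_)
      (h4.denom_pos ?_) (h4.denom_pos ?_) (key ?_) (key ?_) ?_ <;>
      simp only [Digits.lo, Digits.gapLo, Digits.gapHi, Digits.hi] at * <;> linarith

/-- For every `s ≥ 1`, the Minkowski sum `(K(b^s,2) ∪ K(b^s,3) ∪ K(b^s,4)) + K(c^s)`
is the closed interval
`[[0; b^s, 4, \overline{1,3}] + [0; c^s, 4, \overline{1,3}],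
  [0; b^s, 2, \overline{3,1}] + [0; c^s, \overline{1,3}]]`. -/
theorem sum_Kbsj_Kcs (s : ℕ) (hs : 1 ≤ s) :
    (Kb (bW s ++ [2]) ∪ Kb (bW s ++ [3]) ∪ Kb (bW s ++ [4])) + Kb (cW s) =
      Set.Icc
        (cfVal (app (bW s ++ [4]) per13) + cfVal (app (cW s ++ [4]) per13))
        (cfVal (app (bW s ++ [2]) per31) + cfVal (app (cW s) per13)) := by
  obtain ⟨k, rfl⟩ := Nat.exists_eq_add_of_le' hs
  obtain ⟨q, q', h⟩ := exists_incMoebius_wordMap_bW k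
  have hb : ∀ d ∈ bW (k + 1), 1 ≤ d := fun d => one_le_of_mem_bW
  have hk1 : ∀ d ∈ bW k ++ [1], 1 ≤ d := by
    intro d hd
    rcases List.mem_append.1 hd with h | h
    · exact one_le_of_mem_bW h
    · rw [List.mem_singleton.1 h]
  have hcW : cW (k + 1) = (bW k ++ [1]) ++ [3] := by simp [cW]
  have hc : ∀ d ∈ cW (k + 1), 1 ≤ d := by
    rw [hcW]
    intro d hd
    rcases List.mem_append.1 hd with h | h
    · exact hk1 d h
    · simp [List.mem_singleton.1 h]
  have hap : ∀ {w : List ℕ}, (∀ d ∈ w, 1 ≤ d) → ∀ {j : ℕ}, 1 ≤ j → ∀ {θ : ℕ → ℕ}, θ ∈ Dset →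
      cfVal (app (w ++ [j]) θ) = wordMap w (1 / (j + cfVal θ)) := by
    intro w hw j hj θ hθ
    rw [cfVal_app _ (one_le_of_mem_Dset hθ), wordMap_append, wordMap, wordMap]
    intro d hd
    rcases List.mem_append.1 hd with h | h
    · exact hw d h
    · rwa [List.mem_singleton.1 h]
  rw [hap hb (by norm_num) per13_mem_Dset, hap hc (by norm_num) per13_mem_Dset,
    hap hb (by norm_num) per31_mem_Dset, cfVal_app hc (one_le_of_mem_Dset per13_mem_Dset),
    cfVal_per31, Kb_union_eq hb]
  have hKc : Kb (cW (k + 1)) = wordMap (cW (k + 1)) '' Digits.d1234.vals := by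
    rw [hcW, Kb_append_three hk1]
  have eb : wordMap (bW (k + 1)) = fun x => wordMap (bW k) (1 / (1 + 1 / (4 + x))) := by
    funext x
    simp [bW_succ, wordMap_append, wordMap]
  have ec : wordMap (cW (k + 1)) = fun x => wordMap (bW k) (1 / (1 + 1 / (3 + x))) := by
    funext x
    simp [hcW, wordMap_append, wordMap]
  have h4 := h.comp_two (d := 1) (e := 4) le_rfl (by norm_num)
  have h3 := h.comp_two (d := 1) (e := 3) le_rfl (by norm_num)
  have hgaps := gap_le_length h
  rw [← eb] at h4
  rw [← ec] at h3
  rw [← eb, ← ec] at hgaps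
  rw [hKc]
  have lo_nonneg (B : Digits) : 0 ≤ B.lo := by linarith [B.endpoint_ineqs.1]
  have hcompact {w : List ℕ} (hw : ∀ d ∈ w, 1 ≤ d) (B : Digits) :
      IsCompact (wordMap w '' B.vals) :=
    B.isCompact_vals.image_of_continuousOn
      ((continuousOn_wordMap hw).mono fun _ => Digits.nonneg_of_mem_vals)
  apply Subset.antisymm
  · rintro _ ⟨_, ⟨x, hx, rfl⟩, _, ⟨y, hy, rfl⟩, rfl⟩
    have hx' := Digits.vals_d234_subset hx
    have hy' := Digits.vals_d1234_subset hy
    exact ⟨add_le_add (h4.mono (lo_nonneg .d234) hx'.1) (h3.mono (lo_nonneg .d1234) hy'.1),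
      add_le_add (h4.mono ((lo_nonneg .d234).trans hx'.1) hx'.2)
        (h3.mono ((lo_nonneg .d1234).trans hy'.1) hy'.2)⟩
  · intro t ht
    have := mem_closure_add (by norm_num) (fun N => IsBridge.splits) (IsBridge.pos h4 .d234)
      (IsBridge.pos h3 .d1234) hgaps.1 hgaps.2 (t := t) (by exact_mod_cast ht)
    change t ∈ closure (wordMap (bW (k + 1)) '' Digits.d234.vals +
      wordMap (cW (k + 1)) '' Digits.d1234.vals) at this
    rwa [((hcompact hb .d234).add (hcompact hc .d1234)).isClosed.closure_eq] at this
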